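/- arXiv:2205.08162 — 2 statements merged into one kernel-verified Lean document; each statement's English description precedes it below -/
import Mathlib

section
/- Fix s ∈ ℍ. On the open set of quaternions q with Q_{c,s}(q) ≠ 0, applying the Fueter operator to q ↦ S_L^{−1}(s,q) gives D S_L^{−1}(s,q) = −2·Q_{c,s}(q)^{−1} = −2(s² − 2Re(q)s + |q|²)^{−1}; likewise applying the right Fueter operator to q ↦ S_R^{−1}(s,q) gives S_R^{−1}(s,q)D = −2·Q_{c,s}(q)^{−1}. -/
noncomputable section

open Quaternion Finset

def e1 : Quaternion ℝ := ⟨0, 1, 0, 0⟩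
def e2 : Quaternion ℝ := ⟨0, 0, 1, 0⟩
def e3 : Quaternion ℝ := ⟨0, 0, 0, 1⟩

/-- Left Fueter operator `Df = ∂₀f + e₁∂₁f + e₂∂₂f + e₃∂₃f` (real directional derivatives
along `1, e₁, e₂, e₃`). -/
def fueterL (f : Quaternion ℝ → Quaternion ℝ) (q : Quaternion ℝ) : Quaternion ℝ :=
  fderiv ℝ f q 1 + e1 * fderiv ℝ f q e1 + e2 * fderiv ℝ f q e2 + e3 * fderiv ℝ f q e3

/-- Right Fueter operator `fD = ∂₀f + (∂₁f)e₁ + (∂₂f)e₂ + (∂₃f)e₃`. -/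
def fueterR (f : Quaternion ℝ → Quaternion ℝ) (q : Quaternion ℝ) : Quaternion ℝ :=
  fderiv ℝ f q 1 + fderiv ℝ f q e1 * e1 + fderiv ℝ f q e2 * e2 + fderiv ℝ f q e3 * e3

/-- Second directional derivative along `v`. -/
def dir2 (f : Quaternion ℝ → Quaternion ℝ) (v q : Quaternion ℝ) : Quaternion ℝ :=
  fderiv ℝ (fun x => fderiv ℝ f x v) q v

/-- Laplacian in the four real coordinates of a quaternionic variable. -/
def quatLaplacian (f : Quaternion ℝ → Quaternion ℝ) (q : Quaternion ℝ) : Quaternion ℝ :=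
  dir2 f 1 q + dir2 f e1 q + dir2 f e2 q + dir2 f e3 q

/-- `Q_{c,s}(q) = s² − 2 Re(q) s + |q|²` (commutative pseudo Cauchy kernel denominator). -/
def Qcs (s q : Quaternion ℝ) : Quaternion ℝ :=
  s ^ 2 - 2 * (q.re : Quaternion ℝ) * s + ((‖q‖ ^ 2 : ℝ) : Quaternion ℝ)

/-- Left slice hyperholomorphic Cauchy kernel `S_L⁻¹(s,q) = (s − q̄) Q_{c,s}(q)⁻¹` (form II). -/
def SL (s q : Quaternion ℝ) : Quaternion ℝ := (s - star q) * (Qcs s q)⁻¹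

/-- Right slice hyperholomorphic Cauchy kernel `S_R⁻¹(s,q) = Q_{c,s}(q)⁻¹ (s − q̄)` (form II). -/
def SR (s q : Quaternion ℝ) : Quaternion ℝ := (Qcs s q)⁻¹ * (s - star q)

/-- Left F-kernel `F_L(s,q) = −4 (s − q̄) Q_{c,s}(q)⁻²`. -/
def FL (s q : Quaternion ℝ) : Quaternion ℝ := -4 * (s - star q) * ((Qcs s q) ^ 2)⁻¹

/-- Right F-kernel `F_R(s,q) = −4 Q_{c,s}(q)⁻² (s − q̄)`. -/
def FR (s q : Quaternion ℝ) : Quaternion ℝ := -4 * ((Qcs s q) ^ 2)⁻¹ * (s - star q)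

lemma Qcs_eq (s q : Quaternion ℝ) :
    Qcs s q = s * s - (2 * q.re) • s + (‖q‖ ^ 2) • (1 : Quaternion ℝ) := by
  rw [Qcs, sq s, mul_assoc, Quaternion.coe_mul_eq_smul, two_mul, two_mul, add_smul,
    Algebra.smul_def (‖q‖ ^ 2), mul_one, Quaternion.algebraMap_def]

/-- The derivative of `Qcs s` at `q` in the direction `v`. -/
def QcsDeriv (s q v : Quaternion ℝ) : Quaternion ℝ :=
  (2 * inner ℝ q v) • (1 : Quaternion ℝ) - (2 * v.re) • s

lemma hasFDerivAt_quaternion_re (q : Quaternion ℝ) :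
    HasFDerivAt (fun x : Quaternion ℝ => x.re) (innerSL ℝ (1 : Quaternion ℝ)) q :=
  (innerSL ℝ (1 : Quaternion ℝ)).hasFDerivAt.congr_of_eventuallyEq
    (Filter.Eventually.of_forall fun x => by simp [Quaternion.inner_def])

lemma quaternion_star_eq_smul_sub (q : Quaternion ℝ) :
    star q = (2 * q.re) • (1 : Quaternion ℝ) - q := by
  ext <;> simp; ring

lemma exists_hasFDerivAt_star (q : Quaternion ℝ) :
    ∃ L : Quaternion ℝ →L[ℝ] Quaternion ℝ,
      HasFDerivAt (fun x : Quaternion ℝ => star x) L q ∧ ∀ v, L v = star v := by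
  refine ⟨_, ((((hasFDerivAt_quaternion_re q).const_mul 2).smul_const (1 : Quaternion ℝ)).sub
    (hasFDerivAt_id q)).congr_of_eventuallyEq
      (Filter.Eventually.of_forall quaternion_star_eq_smul_sub), fun v => ?_⟩
  rw [quaternion_star_eq_smul_sub v]
  simp [Quaternion.inner_def]

lemma exists_hasFDerivAt_Qcs (s q : Quaternion ℝ) :
    ∃ L : Quaternion ℝ →L[ℝ] Quaternion ℝ,
      HasFDerivAt (Qcs s) L q ∧ ∀ v, L v = QcsDeriv s q v := by
  have hsq := (hasStrictFDerivAt_norm_sq q).hasFDerivAt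
  have hre := (hasFDerivAt_quaternion_re q).const_mul 2
  refine ⟨_, (((hre.smul_const s).const_sub (s * s)).add
    (hsq.smul_const (1 : Quaternion ℝ))).congr_of_eventuallyEq
      (Filter.Eventually.of_forall (Qcs_eq s)), fun v => ?_⟩
  have hv : inner ℝ (1 : Quaternion ℝ) v = v.re := by simp [Quaternion.inner_def]
  simp [QcsDeriv, hv]
  abel

lemma commute_Qcs_inv_QcsDeriv (s q v : Quaternion ℝ) :
    Commute (Qcs s q)⁻¹ (QcsDeriv s q v) := by
  have hs : Commute (Qcs s q) s := by
    rw [Qcs_eq]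
    exact ((((Commute.refl s).mul_left (Commute.refl s)).sub_left
      ((Commute.refl s).smul_left _)).add_left ((Commute.one_left s).smul_left _))
  exact (((Commute.one_right _).smul_right _).sub_right (hs.smul_right _)).inv_left₀

lemma fderiv_SL_apply {s q : Quaternion ℝ} (h : Qcs s q ≠ 0) (v : Quaternion ℝ) :
    fderiv ℝ (SL s) q v = -star v * (Qcs s q)⁻¹ -
      (s - star q) * QcsDeriv s q v * ((Qcs s q)⁻¹ * (Qcs s q)⁻¹) := by
  obtain ⟨L, hL, hv⟩ := exists_hasFDerivAt_Qcs s q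
  obtain ⟨S, hS, hSv⟩ := exists_hasFDerivAt_star q
  have he : fderiv ℝ (SL s) q = _ :=
    ((hS.const_sub s).mul' ((hasFDerivAt_inv' h).comp q hL)).fderiv
  rw [he]
  simp only [add_apply, smul_apply,
    ContinuousLinearMap.comp_apply, neg_apply,
    ContinuousLinearMap.mulLeftRight_apply, hv, hSv, (commute_Qcs_inv_QcsDeriv s q v).eq,
    smul_eq_mul, MulOpposite.smul_eq_mul_unop, MulOpposite.unop_op, Function.comp_apply]
  noncomm_ring

lemma fderiv_SR_apply {s q : Quaternion ℝ} (h : Qcs s q ≠ 0) (v : Quaternion ℝ) :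
    fderiv ℝ (SR s) q v = (Qcs s q)⁻¹ * -star v -
      (Qcs s q)⁻¹ * (Qcs s q)⁻¹ * (QcsDeriv s q v * (s - star q)) := by
  obtain ⟨L, hL, hv⟩ := exists_hasFDerivAt_Qcs s q
  obtain ⟨S, hS, hSv⟩ := exists_hasFDerivAt_star q
  have he : fderiv ℝ (SR s) q = _ :=
    (((hasFDerivAt_inv' h).comp q hL).mul' (hS.const_sub s)).fderiv
  rw [he]
  simp only [add_apply, smul_apply,
    ContinuousLinearMap.comp_apply, neg_apply,
    ContinuousLinearMap.mulLeftRight_apply, hv, hSv, mul_assoc,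
    ← (commute_Qcs_inv_QcsDeriv s q v).eq,
    smul_eq_mul, MulOpposite.smul_eq_mul_unop, MulOpposite.unop_op, Function.comp_apply]
  noncomm_ring

lemma e1_components : e1.re = 0 ∧ e1.imI = 1 ∧ e1.imJ = 0 ∧ e1.imK = 0 := ⟨rfl, rfl, rfl, rfl⟩

lemma e2_components : e2.re = 0 ∧ e2.imI = 0 ∧ e2.imJ = 1 ∧ e2.imK = 0 := ⟨rfl, rfl, rfl, rfl⟩

lemma e3_components : e3.re = 0 ∧ e3.imI = 0 ∧ e3.imJ = 0 ∧ e3.imK = 1 := ⟨rfl, rfl, rfl, rfl⟩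

lemma quaternion_norm_sq_eq (q : Quaternion ℝ) :
    ‖q‖ ^ 2 = q.re ^ 2 + q.imI ^ 2 + q.imJ ^ 2 + q.imK ^ 2 := by
  rw [sq, ← Quaternion.normSq_eq_norm_mul_self, Quaternion.normSq_def']

lemma sum_mul_QcsDeriv (s q : Quaternion ℝ) :
    (s - star q) * QcsDeriv s q 1 + e1 * ((s - star q) * QcsDeriv s q e1) +
      e2 * ((s - star q) * QcsDeriv s q e2) + e3 * ((s - star q) * QcsDeriv s q e3) =
    (-2 : ℝ) • Qcs s q := by
  rw [Qcs_eq, quaternion_norm_sq_eq]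
  ext <;> simp [QcsDeriv, e1_components, e2_components, e3_components, Quaternion.inner_def] <;>
    ring

lemma sum_QcsDeriv_mul (s q : Quaternion ℝ) :
    QcsDeriv s q 1 * (s - star q) + QcsDeriv s q e1 * (s - star q) * e1 +
      QcsDeriv s q e2 * (s - star q) * e2 + QcsDeriv s q e3 * (s - star q) * e3 =
    (-2 : ℝ) • Qcs s q := by
  rw [Qcs_eq, quaternion_norm_sq_eq]
  ext <;> simp [QcsDeriv, e1_components, e2_components, e3_components, Quaternion.inner_def] <;>
    ring

lemma sum_mul_neg_star :
    -star 1 + e1 * -star e1 + e2 * -star e2 + e3 * -star e3 = (-4 : ℝ) • (1 : Quaternion ℝ) := by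
  ext <;> simp [e1_components, e2_components, e3_components]; norm_num

lemma sum_neg_star_mul :
    -star 1 + -star e1 * e1 + -star e2 * e2 + -star e3 * e3 = (-4 : ℝ) • (1 : Quaternion ℝ) := by
  ext <;> simp [e1_components, e2_components, e3_components]; norm_num

lemma fueterL_SL {s q : Quaternion ℝ} (h : Qcs s q ≠ 0) :
    fueterL (SL s) q = -2 * (Qcs s q)⁻¹ := by
  set P := (Qcs s q)⁻¹ with hP
  have hsum : fueterL (SL s) q =
      (-star 1 + e1 * -star e1 + e2 * -star e2 + e3 * -star e3) * P -
      ((s - star q) * QcsDeriv s q 1 + e1 * ((s - star q) * QcsDeriv s q e1) +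
        e2 * ((s - star q) * QcsDeriv s q e2) + e3 * ((s - star q) * QcsDeriv s q e3)) *
        (P * P) := by
    simp only [fueterL, fderiv_SL_apply h, ← hP, add_mul, mul_sub, mul_assoc]
    abel
  rw [hsum, sum_mul_neg_star, sum_mul_QcsDeriv, smul_mul_assoc, smul_mul_assoc, one_mul,
    mul_inv_cancel_left₀ h, ← sub_smul]
  rw [show (-4 - -2 : ℝ) = -2 by norm_num, neg_smul, two_smul, neg_mul, two_mul]

lemma fueterR_SR {s q : Quaternion ℝ} (h : Qcs s q ≠ 0) :
    fueterR (SR s) q = -2 * (Qcs s q)⁻¹ := by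
  set P := (Qcs s q)⁻¹ with hP
  have hsum : fueterR (SR s) q =
      P * (-star 1 + -star e1 * e1 + -star e2 * e2 + -star e3 * e3) -
      P * P * (QcsDeriv s q 1 * (s - star q) + QcsDeriv s q e1 * (s - star q) * e1 +
        QcsDeriv s q e2 * (s - star q) * e2 + QcsDeriv s q e3 * (s - star q) * e3) := by
    simp only [fueterR, fderiv_SR_apply h, ← hP, mul_add, sub_mul, mul_assoc]
    abel
  rw [hsum, sum_neg_star_mul, sum_QcsDeriv_mul, mul_smul_comm, mul_smul_comm, mul_one,
    inv_mul_cancel_right₀ h, ← sub_smul]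
  rw [show (-4 - -2 : ℝ) = -2 by norm_num, neg_smul, two_smul, neg_mul, two_mul]

/-- Applying the Fueter operator to the slice hyperholomorphic Cauchy kernels gives
`D S_L⁻¹(s,q) = −2 Q_{c,s}(q)⁻¹ = −2(s²−2Re(q)s+|q|²)⁻¹` and
`S_R⁻¹(s,q) D = −2 Q_{c,s}(q)⁻¹`. -/
theorem fueter_cauchyKernel (s q : Quaternion ℝ) (h : Qcs s q ≠ 0) :
    fueterL (fun x => SL s x) q = -2 * (Qcs s q)⁻¹ ∧
    fueterL (fun x => SL s x) q
        = -2 * (s ^ 2 - 2 * (q.re : Quaternion ℝ) * s + ((‖q‖ ^ 2 : ℝ) : Quaternion ℝ))⁻¹ ∧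
    fueterR (fun x => SR s x) q = -2 * (Qcs s q)⁻¹ := by
  exact ⟨fueterL_SL h, fueterL_SL h, fueterR_SR h⟩
end
end

section
/- Generalized Q-resolvent equations (quaternionic-kernel form): for every integer m ≥ 1 and all s, q ∈ ℍ with Q_{c,s}(q) ≠ 0, one has Q_{c,s}(q)^{−1}·sᵐ − q̄ᵐ·Q_{c,s}(q)^{−1} = ∑_{i=0}^{m−1} q̄ⁱ·S_L^{−1}(s,q)·s^{m−i−1}, and sᵐ·Q_{c,s}(q)^{−1} − Q_{c,s}(q)^{−1}·q̄ᵐ = ∑_{i=0}^{m−1} s^{m−i−1}·S_R^{−1}(s,q)·q̄ⁱ. -/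
noncomputable section

open Quaternion Finset

/-- The denominator `Q_{c,s}(q)` is a polynomial in `s` with real coefficients. -/
theorem commute_Qcs (s q : Quaternion ℝ) : Commute (Qcs s q) s :=
  (((Commute.refl s).pow_left 2).sub_left
    (((Commute.ofNat_left 2 s).mul_left (Quaternion.coe_commute _ s)).mul_left
      (Commute.refl s))).add_left (Quaternion.coe_commute _ s)

/-- Telescoping identity for a noncommutative ring, with `c` commuting with `s`. -/
theorem sum_pow_mul_sub_mul_pow {R : Type*} [Ring R] {c s : R} (hc : Commute c s) (p : R)
    (m : ℕ) :
    ∑ i ∈ Finset.range m, p ^ i * ((s - p) * c) * s ^ (m - i - 1)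
      = c * s ^ m - p ^ m * c := by
  have hsum := Finset.sum_range_sub' (fun i => p ^ i * c * s ^ (m - i)) m
  simp only [pow_zero, one_mul, Nat.sub_zero, Nat.sub_self, mul_one] at hsum
  rw [← hsum]
  refine Finset.sum_congr rfl fun i hi => ?_
  have hi' : m - i = m - i - 1 + 1 := by
    have := Finset.mem_range.mp hi
    omega
  rw [← Nat.sub_sub, hi', Nat.add_sub_cancel, pow_succ' s, pow_succ p, sub_mul, ← hc.eq]
  noncomm_ring

/-- Mirror image of `sum_pow_mul_sub_mul_pow`. -/
theorem sum_pow_mul_mul_sub_pow {R : Type*} [Ring R] {c s : R} (hc : Commute c s) (p : R)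
    (m : ℕ) :
    ∑ i ∈ Finset.range m, s ^ (m - i - 1) * (c * (s - p)) * p ^ i
      = s ^ m * c - c * p ^ m := by
  have hop := sum_pow_mul_sub_mul_pow hc.op (MulOpposite.op p) m
  apply MulOpposite.op_injective
  simpa [mul_assoc] using hop

/-- Generalized Q-resolvent equations in quaternionic-kernel form: for `m ≥ 1` and
`Q_{c,s}(q) ≠ 0`,
`Q_{c,s}(q)⁻¹ sᵐ − q̄ᵐ Q_{c,s}(q)⁻¹ = ∑_{i=0}^{m−1} q̄ⁱ S_L⁻¹(s,q) s^{m−i−1}` and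
`sᵐ Q_{c,s}(q)⁻¹ − Q_{c,s}(q)⁻¹ q̄ᵐ = ∑_{i=0}^{m−1} s^{m−i−1} S_R⁻¹(s,q) q̄ⁱ`. -/
theorem generalized_Qresolvent (m : ℕ) (hm : 1 ≤ m) (s q : Quaternion ℝ)
    (h : Qcs s q ≠ 0) :
    (Qcs s q)⁻¹ * s ^ m - (star q) ^ m * (Qcs s q)⁻¹
        = ∑ i ∈ Finset.range m, (star q) ^ i * SL s q * s ^ (m - i - 1) ∧
    s ^ m * (Qcs s q)⁻¹ - (Qcs s q)⁻¹ * (star q) ^ m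
        = ∑ i ∈ Finset.range m, s ^ (m - i - 1) * SR s q * (star q) ^ i := by
  have hc : Commute (Qcs s q)⁻¹ s := (commute_Qcs s q).inv_left₀
  exact ⟨(sum_pow_mul_sub_mul_pow hc (star q) m).symm,
    (sum_pow_mul_mul_sub_pow hc (star q) m).symm⟩
end
end
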